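/- There is no nondegenerate simplicial map from X(F_2^4) to X(F_3^4): there is no function f : (Fin 4 → ZMod 2) → (Fin 4 → ZMod 3) such that for every finset s of vectors in (Fin 4 → ZMod 2) that is linearly independent over ZMod 2, the family (f v) for v ∈ s is linearly independent over ZMod 3. -/

import Mathlib

/-- Natural number coordinates of a vector of length four. -/
abbrev Quad : Type := ℕ × ℕ × ℕ × ℕ

namespace Quad

/-- The vector over `R` with the given coordinates. -/
def toVec (R : Type*) [NatCast R] (a : Quad) : Fin 4 → R :=
  ![(a.1 : R), (a.2.1 : R), (a.2.2.1 : R), (a.2.2.2 : R)]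

/-- The determinant of the `3 × 3` matrix with the given rows. -/
def det₃ (a b c : ℕ × ℕ × ℕ) : ℤ :=
  (a.1 * (b.2.1 * c.2.2) + a.2.1 * (b.2.2 * c.1) + a.2.2 * (b.1 * c.2.1) : ℕ) -
    (a.1 * (b.2.2 * c.2.1) + a.2.1 * (b.1 * c.2.2) + a.2.2 * (b.2.1 * c.1) : ℕ)

/-- The determinant of the `4 × 4` matrix with the given rows. -/
def det (a b c d : Quad) : ℤ :=
  a.1 * det₃ b.2 c.2 d.2 - b.1 * det₃ a.2 c.2 d.2 + c.1 * det₃ a.2 b.2 d.2 -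
    d.1 * det₃ a.2 b.2 c.2

theorem det_toVec (R : Type*) [CommRing R] (a b c d : Quad) :
    (Matrix.of ![a.toVec R, b.toVec R, c.toVec R, d.toVec R]).det = (det a b c d : R) := by
  simp [Matrix.det_succ_row_zero, Fin.sum_univ_succ, toVec, det, det₃, Fin.succAbove]
  ring

/-- Zero and a representative of every point of the projective space of `F_3^4`. -/
def candidates : List Quad :=
  (0, 0, 0, 0) :: (0, 0, 0, 1) :: [0, 1, 2].flatMap fun d =>
    (0, 0, 1, d) :: [0, 1, 2].flatMap fun c =>
      (0, 1, c, d) :: [0, 1, 2].map fun b => (1, b, c, d)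

theorem exists_mem_candidates (v : Fin 4 → ZMod 3) :
    ∃ y ∈ candidates, ∃ ε : (ZMod 3)ˣ, v = ε • y.toVec (ZMod 3) := by
  revert v
  decide +kernel

/-- Some three of the listed pairs, together with `p`, have independent first components over `F_2`
and dependent second components over `F_3`. -/
def conflict (p : Quad × Quad) : List (Quad × Quad) → Bool
  | [] => false
  | q :: l => conflict p l || l.tails.any fun
    | [] => false
    | r :: l' => l'.any fun s =>
      det p.1 q.1 r.1 s.1 % 2 == 1 && det p.2 q.2 r.2 s.2 % 3 == 0

/-- Backtracking search: no assignment of candidates to the vectors of the second list extends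
the first list without a conflict. -/
def refute (asg : List (Quad × Quad)) : List Quad → Bool
  | [] => false
  | x :: todo => candidates.all fun y =>
    conflict (x, y) asg || refute ((x, y) :: asg) todo

/-- The vectors of a projective frame, each paired with itself. -/
def frame : List (Quad × Quad) :=
  [((1, 1, 1, 1), (1, 1, 1, 1)), ((1, 0, 0, 0), (1, 0, 0, 0)), ((0, 1, 0, 0), (0, 1, 0, 0)),
   ((0, 0, 1, 0), (0, 0, 1, 0)), ((0, 0, 0, 1), (0, 0, 0, 1))]

/-- The nonzero vectors of `F_2^4` outside the frame, in an order that keeps the search small. -/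
def offFrame : List Quad :=
  [(1, 0, 1, 1), (1, 1, 0, 1), (1, 1, 1, 0), (0, 1, 1, 1), (1, 0, 1, 0), (0, 0, 1, 1),
   (0, 1, 1, 0), (1, 0, 0, 1), (1, 1, 0, 0), (0, 1, 0, 1)]

theorem refute_frame : refute frame offFrame = true := by
  decide +kernel

/-- The map `g` sends the first vector to a nonzero multiple of the second one. -/
def Maps (g : (Fin 4 → ZMod 2) → Fin 4 → ZMod 3) (p : Quad × Quad) : Prop :=
  ∃ ε : (ZMod 3)ˣ, g (p.1.toVec (ZMod 2)) = ε • p.2.toVec (ZMod 3)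

variable {g : (Fin 4 → ZMod 2) → Fin 4 → ZMod 3}

theorem det_ne_zero_of_maps
    (hg : ∀ v : Fin 4 → Fin 4 → ZMod 2,
      LinearIndependent (ZMod 2) v → LinearIndependent (ZMod 3) (g ∘ v))
    {p q r s : Quad × Quad} (hp : Maps g p) (hq : Maps g q) (hr : Maps g r) (hs : Maps g s)
    (h : det p.1 q.1 r.1 s.1 % 2 = 1) : det p.2 q.2 r.2 s.2 % 3 ≠ 0 := by
  obtain ⟨ε₁, hp⟩ := hp
  obtain ⟨ε₂, hq⟩ := hq
  obtain ⟨ε₃, hr⟩ := hr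
  obtain ⟨ε₄, hs⟩ := hs
  have h₂ : (det p.1 q.1 r.1 s.1 : ZMod 2) ≠ 0 := by
    intro h0
    have := (ZMod.intCast_zmod_eq_zero_iff_dvd _ 2).1 h0
    omega
  rw [← det_toVec, ← isUnit_iff_ne_zero, ← Matrix.isUnit_iff_isUnit_det,
    ← Matrix.linearIndependent_rows_iff_isUnit] at h₂
  have h₃ := hg _ h₂
  have hsmul : g ∘ (Matrix.of ![p.1.toVec (ZMod 2), q.1.toVec _, r.1.toVec _, s.1.toVec _]).row =
      ![ε₁, ε₂, ε₃, ε₄] • (Matrix.of ![p.2.toVec (ZMod 3), q.2.toVec _, r.2.toVec _,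
        s.2.toVec _]).row := by
    funext i
    fin_cases i
    exacts [hp, hq, hr, hs]
  rw [hsmul, LinearIndependent.units_smul_iff, Matrix.linearIndependent_rows_iff_isUnit,
    Matrix.isUnit_iff_isUnit_det, isUnit_iff_ne_zero, det_toVec] at h₃
  intro h0
  exact h₃ ((ZMod.intCast_zmod_eq_zero_iff_dvd _ 3).2 (Int.dvd_of_emod_eq_zero h0))

theorem conflict_eq_false
    (hg : ∀ v : Fin 4 → Fin 4 → ZMod 2,
      LinearIndependent (ZMod 2) v → LinearIndependent (ZMod 3) (g ∘ v))
    {p : Quad × Quad} (hp : Maps g p) :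
    ∀ {l : List (Quad × Quad)}, (∀ q ∈ l, Maps g q) → conflict p l = false
  | [], _ => rfl
  | q :: l, hl => by
    rw [conflict, conflict_eq_false hg hp fun q hq => hl q (List.mem_cons_of_mem _ hq),
      Bool.false_or, List.any_eq_false]
    intro t ht
    have htl := (List.mem_tails _ _).1 ht
    match t with
    | [] => simp
    | r :: t =>
      simp only [List.any_eq_true, Bool.and_eq_true, beq_iff_eq, not_exists, not_and]
      intro s hs h₂
      have hmem (x) (hx : x ∈ r :: t) : Maps g x :=
        hl x (List.mem_cons_of_mem _ (htl.subset hx))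
      exact det_ne_zero_of_maps hg hp (hl q List.mem_cons_self) (hmem r List.mem_cons_self)
        (hmem s (List.mem_cons_of_mem _ hs)) h₂

theorem refute_eq_false
    (hg : ∀ v : Fin 4 → Fin 4 → ZMod 2,
      LinearIndependent (ZMod 2) v → LinearIndependent (ZMod 3) (g ∘ v))
    (todo : List Quad) {asg : List (Quad × Quad)} (h : ∀ p ∈ asg, Maps g p) :
    refute asg todo = false := by
  induction todo generalizing asg with
  | nil => rfl
  | cons x todo ih =>
    obtain ⟨y, hy, hxy⟩ := exists_mem_candidates (g (x.toVec (ZMod 2)))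
    rw [refute, List.all_eq_false]
    refine ⟨y, hy, ?_⟩
    have hmaps : Maps g (x, y) := hxy
    simp [conflict_eq_false hg hmaps h, ih (List.forall_mem_cons.2 ⟨hmaps, h⟩)]

end Quad

/-- If `w` can replace every vector of the basis `e`, then some change of coordinates sends `w` to
the all-ones vector and each `e i` to a nonzero multiple of the standard basis vector. -/
theorem exists_frame_normalization {K V ι : Type*} [Field K] [AddCommGroup V] [Module K V]
    [Fintype ι] [DecidableEq ι] (e : Module.Basis ι K V) (w : V)
    (hw : ∀ i, LinearIndependent K (Function.update e i w)) :
    ∃ (L : V ≃ₗ[K] (ι → K)) (c : ι → Kˣ), L w = 1 ∧ ∀ i, L (e i) = c i • Pi.single i 1 := by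
  have hne (i : ι) : e.repr w i ≠ 0 := by
    intro h0
    have hni := (hw i).notMem_span_image (s := {i}ᶜ) (x := i) (by simp)
    have himage : Function.update e i w '' {i}ᶜ = e '' {i}ᶜ :=
      Set.image_congr fun j hj => Function.update_of_ne hj _ _
    rw [himage, Function.update_self, e.mem_span_image] at hni
    refine hni fun j hj => ?_
    rintro rfl
    exact Finsupp.mem_support_iff.1 hj h0
  let c (i : ι) : Kˣ := Units.mk0 _ (hne i)
  refine ⟨(e.unitsSMul c).equivFun, fun i => (c i)⁻¹, ?_, fun i => ?_⟩
  · funext i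
    rw [Module.Basis.equivFun_apply, e.repr_unitsSMul, Units.smul_def, smul_eq_mul]
    exact (c i).inv_mul
  · funext j
    rw [Module.Basis.equivFun_apply, e.repr_unitsSMul, e.repr_self, Pi.smul_apply]
    rcases eq_or_ne j i with rfl | hij
    · simp
    · simp [hij, Finsupp.single_eq_of_ne]

/-- A map preserving independence of finite sets preserves independence of finite families. -/
theorem linearIndependent_comp_of_finset {K L V W ι : Type*} [Field K] [Field L] [AddCommGroup V]
    [Module K V] [AddCommGroup W] [Module L W] [Fintype ι] {f : V → W}
    (hf : ∀ s : Finset V, LinearIndependent K (fun v : s => v.1) →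
      LinearIndependent L (fun v : s => f v.1))
    {v : ι → V} (hv : LinearIndependent K v) : LinearIndependent L (f ∘ v) := by
  classical
  let s : Finset V := Finset.univ.image v
  have hs (i : ι) : v i ∈ s := Finset.mem_image_of_mem v (Finset.mem_univ i)
  have h := hf s ((hv.linearIndepOn_id).mono (by simp [s]))
  exact h.comp (fun i => ⟨v i, hs i⟩) fun i j hij => hv.injective (congrArg Subtype.val hij)

open Quad in
/-- There is no nondegenerate simplicial map from `X(F_2^4)` to `X(F_3^4)`. -/
theorem stmt13 :
    ¬ ∃ f : (Fin 4 → ZMod 2) → (Fin 4 → ZMod 3),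
      ∀ s : Finset (Fin 4 → ZMod 2),
        LinearIndependent (ZMod 2) (fun v : s => (v.1 : Fin 4 → ZMod 2)) →
        LinearIndependent (ZMod 3) (fun v : s => f v.1) := by
  rintro ⟨f, hf⟩
  have hcomp {v : Fin 4 → Fin 4 → ZMod 2} (hv : LinearIndependent (ZMod 2) v) :
      LinearIndependent (ZMod 3) (f ∘ v) := linearIndependent_comp_of_finset hf hv
  let u (i : Fin 4) : Fin 4 → ZMod 2 := Pi.single i 1
  have hu : LinearIndependent (ZMod 2) u := Pi.linearIndependent_single_one _ _
  let e := basisOfLinearIndependentOfCardEqFinrank (hcomp hu) (by simp)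
  have he : ⇑e = f ∘ u := coe_basisOfLinearIndependentOfCardEqFinrank _ _
  have hw (i : Fin 4) : LinearIndependent (ZMod 3) (Function.update e i (f 1)) := by
    rw [he, ← Function.comp_update]
    apply hcomp
    change LinearIndependent (ZMod 2) (Matrix.of (Function.update u i 1)).row
    rw [Matrix.linearIndependent_rows_iff_isUnit, Matrix.isUnit_iff_isUnit_det,
      isUnit_iff_ne_zero]
    revert i
    decide +kernel
  obtain ⟨L, c, hone, hsingle⟩ := exists_frame_normalization e (f 1) hw
  have hg (v : Fin 4 → Fin 4 → ZMod 2) (hv : LinearIndependent (ZMod 2) v) :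
      LinearIndependent (ZMod 3) ((L ∘ f) ∘ v) := (hcomp hv).map' L.toLinearMap L.ker
  have hmaps (i : Fin 4) (x : Quad) (h₂ : x.toVec (ZMod 2) = Pi.single i 1)
      (h₃ : x.toVec (ZMod 3) = Pi.single i 1) : Maps (L ∘ f) (x, x) := by
    refine ⟨c i, ?_⟩
    rw [h₂, h₃, ← hsingle, he]
    rfl
  have hframe : ∀ p ∈ frame, Maps (L ∘ f) p := by
    simp only [frame, List.forall_mem_cons]
    refine ⟨⟨1, ?_⟩, hmaps 0 _ ?_ ?_, hmaps 1 _ ?_ ?_, hmaps 2 _ ?_ ?_, hmaps 3 _ ?_ ?_, ?_⟩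
    · rw [show toVec (ZMod 2) (1, 1, 1, 1) = 1 by decide, Function.comp_apply, hone]
      decide
    all_goals first | decide | simp
  exact Bool.false_ne_true ((refute_eq_false hg offFrame hframe).symm.trans refute_frame)
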